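/- arXiv:1908.09365 — 4 statements merged into one kernel-verified Lean document; each statement's English description precedes it below -/
import Mathlib

section
/- Let a > 0, B̃ > 0, δ > 0, b ∈ ℝ, and let (λ_n) be a positive decreasing sequence with λ_n = (a n + b + O(n^{-δ}))^{-B̃}. Then there exist a constant C > 0 and N such that for all n ≥ N and all 1 ≤ k < n, λ_n / (λ_k − λ_n) ≤ C (k/n)^{B̃} / (1 − (k/n)^{B̃}) + C n^{-min{1, B̃}}. -/
/-- `lam n = (a * n + b + O(n ^ (-δ)))^(-B')` as `n → ∞` (the sequence is indexed from `1`;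
the value `lam 0` is irrelevant). -/
def HasTwoTermAsymp (lam : ℕ → ℝ) (a b B' δ : ℝ) : Prop :=
  ∃ (r : ℕ → ℝ) (C : ℝ) (N : ℕ), 1 ≤ N ∧
    (∀ n, N ≤ n → |r n| ≤ C * (n : ℝ) ^ (-δ)) ∧
    ∀ n, N ≤ n → lam n = (a * n + b + r n) ^ (-B')

open Filter Topology in
/-- The perturbed indices `a n + b + r n` are eventually comparable to `a n`. -/
theorem HasTwoTermAsymp.exists_index {lam : ℕ → ℝ} {a b B' δ : ℝ} (ha : 0 < a) (hδ : 0 < δ)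
    (h : HasTwoTermAsymp lam a b B' δ) :
    ∃ (s : ℕ → ℝ) (K : ℕ), 1 ≤ K ∧ (∀ n, K ≤ n → lam n = s n ^ (-B')) ∧
      (∀ n, K ≤ n → a / 2 * n ≤ s n ∧ s n ≤ 2 * a * n) ∧
      ∀ k n, K ≤ k → k < n → a / 2 * ((n : ℝ) - k) ≤ s n - s k := by
  obtain ⟨r, C, N, hN, hr, hlam⟩ := h
  have hlim : Tendsto (fun n : ℕ => C * (n : ℝ) ^ (-δ)) atTop (𝓝 0) := by
    simpa using ((tendsto_rpow_neg_atTop hδ).comp tendsto_natCast_atTop_atTop).const_mul C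
  obtain ⟨N₁, hN₁⟩ := eventually_atTop.1 (hlim.eventually_le_const (show 0 < a / 4 by positivity))
  obtain ⟨N₂, hN₂⟩ := exists_nat_ge ((|b| + a / 4) / (a / 2))
  rw [div_le_iff₀ (by positivity)] at hN₂
  have hra : ∀ n, N + N₁ + N₂ ≤ n → |r n| ≤ a / 4 := fun n hn =>
    (hr n (by omega)).trans (hN₁ n (by omega))
  refine ⟨fun n => a * n + b + r n, N + N₁ + N₂, by omega, fun n hn => hlam n (by omega),
    fun n hn => ?_, fun k n hk hkn => ?_⟩
  · have h1 := abs_le.1 (hra n hn)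
    have h2 : (N₂ : ℝ) ≤ n := by exact_mod_cast (by omega : N₂ ≤ n)
    have h3 : (N₂ : ℝ) * (a / 2) ≤ n * (a / 2) := by gcongr
    have h4 := le_abs_self b
    have h5 := neg_abs_le b
    have h6 : (0 : ℝ) ≤ a * n := by positivity
    constructor <;> linarith [h1.1, h1.2]
  · have h1 := abs_le.1 (hra n (by omega))
    have h2 := abs_le.1 (hra k hk)
    have h3 : (k : ℝ) + 1 ≤ n := by exact_mod_cast hkn
    have h4 : 0 ≤ a * ((n : ℝ) - k - 1) := mul_nonneg ha.le (by linarith)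
    linarith [h1.1, h2.2]

/-- Contracting `t ≥ 1` towards `1` by a factor `1 / 4` costs at most a constant factor
in `t ^ B - 1`. -/
theorem rpow_sub_one_le_mul_contract {B t : ℝ} (hB : 0 < B) (ht : 1 ≤ t) :
    t ^ B - 1 ≤ 8 * 4 ^ B * ((1 + (t - 1) / 4) ^ B - 1) := by
  have ht0 : 0 < t := by linarith
  have hM : (0 : ℝ) < 4 ^ B := by positivity
  rcases le_total (2 * 4 ^ B) (t ^ B) with h | h
  · have h1 : (t / 4) ^ B ≤ (1 + (t - 1) / 4) ^ B :=
      Real.rpow_le_rpow (by positivity) (by linarith) hB.le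
    rw [Real.div_rpow ht0.le (by norm_num), div_le_iff₀ hM] at h1
    nlinarith
  · have hamgm : t ^ (1 / 4 : ℝ) ≤ 1 + (t - 1) / 4 := by
      have := rpow_one_add_le_one_add_mul_self (s := t - 1) (p := 1 / 4)
        (by linarith) (by norm_num) (by norm_num)
      rw [add_sub_cancel] at this
      linarith
    have h1 : (t ^ (1 / 4 : ℝ)) ^ B ≤ (1 + (t - 1) / 4) ^ B :=
      Real.rpow_le_rpow (by positivity) hamgm hB.le
    have hw1 : 1 ≤ (t ^ (1 / 4 : ℝ)) ^ B :=
      Real.one_le_rpow (Real.one_le_rpow ht (by norm_num)) hB.le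
    have hw4 : ((t ^ (1 / 4 : ℝ)) ^ B) ^ 4 = t ^ B := by
      rw [← Real.rpow_mul ht0.le, ← Real.rpow_natCast, ← Real.rpow_mul ht0.le]
      congr 1
      push_cast
      ring
    set w := (t ^ (1 / 4 : ℝ)) ^ B
    have hw3 : w ^ 3 ≤ w ^ 4 := pow_le_pow_right₀ hw1 (by norm_num)
    have hw2 : w ^ 2 ≤ w ^ 4 := pow_le_pow_right₀ hw1 (by norm_num)
    have hw : w ≤ w ^ 4 := le_self_pow₀ hw1 (by norm_num)
    have hw0 : 1 ≤ w ^ 4 := one_le_pow₀ hw1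
    calc t ^ B - 1 = (w ^ 3 + w ^ 2 + w + 1) * (w - 1) := by rw [← hw4]; ring
      _ ≤ (8 * 4 ^ B) * (w - 1) :=
          mul_le_mul_of_nonneg_right (by linarith) (by linarith)
      _ ≤ _ := by gcongr

/-- If `(lam n)` is a positive decreasing sequence with
`lam n = (a n + b + O(n^(-δ)))^(-B')`, then there are `C > 0` and `N` such that for all
`n ≥ N` and all `1 ≤ k < n`,
`lam n / (lam k - lam n) ≤ C (k/n)^B' / (1 - (k/n)^B') + C n^(-min 1 B')`. -/
theorem eigenvalue_ratio_bound_lower_range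
    (a b B' δ : ℝ) (ha : 0 < a) (hB' : 0 < B') (hδ : 0 < δ)
    (lam : ℕ → ℝ)
    (hpos : ∀ n, 1 ≤ n → 0 < lam n)
    (hdec : ∀ m n, 1 ≤ m → m ≤ n → lam n ≤ lam m)
    (hasymp : HasTwoTermAsymp lam a b B' δ) :
    ∃ C > (0 : ℝ), ∃ N : ℕ, ∀ n, N ≤ n → ∀ k, 1 ≤ k → k < n →
      lam n / (lam k - lam n) ≤
        C * ((k : ℝ) / n) ^ B' / (1 - ((k : ℝ) / n) ^ B') + C * (n : ℝ) ^ (-min 1 B') := by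
  obtain ⟨s, K, hK, hlam, hs, hdiff⟩ := hasymp.exists_index ha hδ
  have hsK : ∀ n, K ≤ n → 0 < s n := fun n hn =>
    lt_of_lt_of_le (mul_pos (by positivity) (by exact_mod_cast (by omega : 0 < n))) (hs n hn).1
  have hupper : ∀ n, K ≤ n → lam n ≤ (a / 2) ^ (-B') * (n : ℝ) ^ (-B') := fun n hn => by
    have hn0 : (0 : ℝ) < n := by exact_mod_cast (by omega : 0 < n)
    rw [hlam n hn, ← Real.mul_rpow (by positivity) hn0.le]
    exact Real.rpow_le_rpow_of_nonpos (by positivity) (hs n hn).1 (by linarith)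
  have hlim : Filter.Tendsto (fun n : ℕ => (a / 2) ^ (-B') * (n : ℝ) ^ (-B')) Filter.atTop
      (nhds 0) := by
    simpa using ((tendsto_rpow_neg_atTop hB').comp tendsto_natCast_atTop_atTop).const_mul
      ((a / 2) ^ (-B'))
  have hlamK : 0 < lam K := hpos K hK
  obtain ⟨N, hN⟩ := Filter.eventually_atTop.1
    (hlim.eventually_le_const (show 0 < lam K / 2 by positivity))
  set C₁ : ℝ := 8 * 4 ^ B'
  set C₂ : ℝ := 2 * (a / 2) ^ (-B') / lam K
  have hC₁ : 0 < C₁ := by positivity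
  have hC₂ : 0 < C₂ := by positivity
  refine ⟨C₁ + C₂, by positivity, K + N, fun n hn k hk hkn => ?_⟩
  have hk0 : (0 : ℝ) < k := by exact_mod_cast hk
  have hn0 : (0 : ℝ) < n := by exact_mod_cast (by omega : 0 < n)
  have hkn' : (k : ℝ) < n := by exact_mod_cast hkn
  have hx1 : ((k : ℝ) / n) ^ B' < 1 :=
    Real.rpow_lt_one (by positivity) ((div_lt_one hn0).2 hkn') hB'
  have hx0 : 0 < ((k : ℝ) / n) ^ B' := by positivity
  have hlast : 0 ≤ (C₁ + C₂) * (n : ℝ) ^ (-min 1 B') := by positivity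
  refine le_trans ?_ (le_add_of_nonneg_right hlast)
  have hln := hpos n (by omega)
  rcases lt_or_ge k K with hkK | hKk
  · have h1 := (hupper n (by omega)).trans (hN n (by omega))
    have h2 := hdec k K hk hkK.le
    have h3 : (n : ℝ) ^ (-B') ≤ ((k : ℝ) / n) ^ B' := by
      rw [Real.rpow_neg hn0.le, ← Real.inv_rpow hn0.le, inv_eq_one_div]
      have : (1 : ℝ) ≤ k := by exact_mod_cast hk
      gcongr
    calc lam n / (lam k - lam n) ≤ lam n / (lam K / 2) := by
          gcongr
          linarith
      _ ≤ (a / 2) ^ (-B') * (n : ℝ) ^ (-B') / (lam K / 2) := by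
          gcongr
          exact hupper n (by omega)
      _ = C₂ * (n : ℝ) ^ (-B') := by
          simp only [C₂]
          field_simp
      _ ≤ (C₁ + C₂) * ((k : ℝ) / n) ^ B' := by
          gcongr
          linarith
      _ ≤ (C₁ + C₂) * ((k : ℝ) / n) ^ B' / (1 - ((k : ℝ) / n) ^ B') :=
          le_div_self (by positivity) (by linarith) (by linarith)
  · have hsk := hsK k hKk
    have hsn := hsK n (by omega)
    have hratio : lam k = lam n * (s n / s k) ^ B' := by
      rw [hlam k hKk, hlam n (by omega), Real.div_rpow hsn.le hsk.le, Real.rpow_neg hsk.le,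
        Real.rpow_neg hsn.le]
      have := Real.rpow_pos_of_pos hsn B'
      field_simp
    have hbase : 1 + ((n : ℝ) / k - 1) / 4 ≤ s n / s k := by
      rw [le_div_iff₀ hsk]
      have h1 := (hs k hKk).2
      have h2 := hdiff k n hKk hkn
      have h3 : ((n : ℝ) / k - 1) / 4 * s k ≤ ((n : ℝ) / k - 1) / 4 * (2 * a * k) := by
        have : 1 ≤ (n : ℝ) / k := (one_le_div hk0).2 hkn'.le
        exact mul_le_mul_of_nonneg_left h1 (by linarith)
      have h4 : ((n : ℝ) / k - 1) / 4 * (2 * a * k) = a / 2 * ((n : ℝ) - k) := by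
        field_simp
        ring
      linarith
    have ht : 1 < (n : ℝ) / k := (one_lt_div hk0).2 hkn'
    have hy : 1 < ((n : ℝ) / k) ^ B' := Real.one_lt_rpow ht hB'
    have hpow : (1 + ((n : ℝ) / k - 1) / 4) ^ B' ≤ (s n / s k) ^ B' :=
      Real.rpow_le_rpow (by linarith) hbase hB'.le
    have hkey : ((n : ℝ) / k) ^ B' - 1 ≤ C₁ * ((s n / s k) ^ B' - 1) :=
      (rpow_sub_one_le_mul_contract hB' ht.le).trans (by gcongr)
    have hxy : ((k : ℝ) / n) ^ B' = (((n : ℝ) / k) ^ B')⁻¹ := by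
      rw [← Real.inv_rpow (by positivity), inv_div]
    have hR : 0 < (s n / s k) ^ B' - 1 := pos_of_mul_pos_right (by linarith) hC₁.le
    rw [hxy, hratio]
    set y := ((n : ℝ) / k) ^ B'
    set R := (s n / s k) ^ B'
    have hy1 : 0 < y - 1 := by linarith
    calc lam n / (lam n * R - lam n) = 1 / (R - 1) := by
          rw [← mul_sub_one]
          field_simp
      _ ≤ (C₁ + C₂) / (y - 1) := by
          rw [div_le_div_iff₀ hR hy1]
          nlinarith
      _ = (C₁ + C₂) * y⁻¹ / (1 - y⁻¹) := by
          have : 0 < y := by linarith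
          have : 1 - y⁻¹ = (y - 1) / y := by field_simp
          rw [this]
          field_simp
end

section
/- Let a > 0, B̃ > 0, δ > 0, b ∈ ℝ, and let (λ_n) be a positive decreasing sequence with λ_n = (a n + b + O(n^{-δ}))^{-B̃}. Then there exist a constant C > 0 and N such that for all n ≥ N and all k > n, λ_n / (λ_n − λ_k) ≤ C (k/n)^{B̃} / ((k/n)^{B̃} − 1) + C n^{-min{1, B̃}}. -/
/-- If `x > 0` dominates `y * u` with `u > 1`, the ratio `x / (x - y)` is at most
`4 * u ^ 4 / (u ^ 4 - 1)`. -/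
lemma div_sub_le_four_mul_pow_div {x y u : ℝ} (hx : 0 < x) (hu : 1 < u) (h : y * u ≤ x) :
    x / (x - y) ≤ 4 * u ^ 4 / (u ^ 4 - 1) := by
  have hxy : 0 < x - y := by
    by_contra! hle
    nlinarith
  have hu4 : 0 < u ^ 4 - 1 := sub_pos.2 (one_lt_pow₀ hu (by norm_num))
  calc x / (x - y) ≤ u / (u - 1) := by
        rw [div_le_div_iff₀ hxy (by linarith)]
        nlinarith
    _ ≤ 4 * u ^ 4 / (u ^ 4 - 1) := by
        rw [div_le_div_iff₀ (by linarith) hu4]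
        have h2 : 1 ≤ u ^ 2 := one_le_pow₀ hu.le
        have h3 : u ^ 2 ≤ u ^ 3 := pow_le_pow_right₀ hu.le (by norm_num)
        have h1 : u ≤ u ^ 2 := by nlinarith
        have h0 : 0 ≤ u * (u - 1) * (4 * u ^ 3 - (u ^ 3 + u ^ 2 + u + 1)) :=
          mul_nonneg (mul_nonneg (by linarith) (by linarith)) (by linarith)
        nlinarith

/-- If `(lam n)` is a positive decreasing sequence with
`lam n = (a n + b + O(n^(-δ)))^(-B')`, then there are `C > 0` and `N` such that for all
`n ≥ N` and all `k > n`,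
`lam n / (lam n - lam k) ≤ C (k/n)^B' / ((k/n)^B' - 1) + C n^(-min 1 B')`. -/
theorem eigenvalue_ratio_bound_upper_range
    (a b B' δ : ℝ) (ha : 0 < a) (hB' : 0 < B') (hδ : 0 < δ)
    (lam : ℕ → ℝ)
    (hpos : ∀ n, 1 ≤ n → 0 < lam n)
    (hdec : ∀ m n, 1 ≤ m → m ≤ n → lam n ≤ lam m)
    (hasymp : HasTwoTermAsymp lam a b B' δ) :
    ∃ C > (0 : ℝ), ∃ N : ℕ, ∀ n, N ≤ n → ∀ k, n < k →
      lam n / (lam n - lam k) ≤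
        C * ((k : ℝ) / n) ^ B' / (((k : ℝ) / n) ^ B' - 1) + C * (n : ℝ) ^ (-min 1 B') := by
  obtain ⟨r, C₀, N₀, hN₀, hr, hlam⟩ := hasymp
  have hlim : Filter.Tendsto (fun n : ℕ => C₀ * (n : ℝ) ^ (-δ)) Filter.atTop (nhds 0) := by
    simpa using ((tendsto_rpow_neg_atTop hδ).comp tendsto_natCast_atTop_atTop).const_mul C₀
  have hsmall := hlim.eventually (ge_mem_nhds (show (0 : ℝ) < a / 4 by positivity))
  have hlin : Filter.Tendsto (fun n : ℕ => a * (n : ℝ)) Filter.atTop Filter.atTop :=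
    tendsto_natCast_atTop_atTop.const_mul_atTop ha
  obtain ⟨N, hN⟩ := Filter.eventually_atTop.1
    (hsmall.and ((hlin.eventually_ge_atTop (|b| + a)).and (Filter.eventually_ge_atTop N₀)))
  refine ⟨4, by norm_num, N, fun n hn k hk => ?_⟩
  obtain ⟨hn1, hn2, hn3⟩ := hN n hn
  obtain ⟨hk1, -, hk3⟩ := hN k (hn.trans hk.le)
  have hrn := abs_le.1 ((hr n hn3).trans hn1)
  have hrk := abs_le.1 ((hr k hk3).trans hk1)
  have hb := abs_le.1 (le_refl |b|)
  have hnpos : (0 : ℝ) < n := by exact_mod_cast hN₀.trans hn3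
  have hnk : (n : ℝ) + 1 ≤ k := by exact_mod_cast hk
  set x : ℝ := (k : ℝ) / n with hx
  have hx1 : 1 < x := (one_lt_div hnpos).2 (by linarith)
  have hx0 : 0 ≤ x := by linarith
  have hkx : (k : ℝ) = x * n := by rw [hx]; field_simp
  have hcn : 0 < a * n + b + r n := by linarith
  have hbern : x ^ (1 / 4 : ℝ) ≤ 1 + 1 / 4 * (x - 1) := by
    have := rpow_one_add_le_one_add_mul_self (s := x - 1) (by linarith)
      (p := 1 / 4) (by norm_num) (by norm_num)
    simpa using this
  have hgrow : x ^ (1 / 4 : ℝ) * (a * n + b + r n) ≤ a * k + b + r k := by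
    calc x ^ (1 / 4 : ℝ) * (a * n + b + r n)
        ≤ (1 + 1 / 4 * (x - 1)) * (a * n + b + r n) := by gcongr
      _ = (a * n + b + r n) + 1 / 4 * (x - 1) * (a * n + b + r n) := by ring
      _ ≤ (a * n + b + r n) + 1 / 4 * (x - 1) * (2 * (a * n)) := by
          have : 0 ≤ x - 1 := by linarith
          gcongr
          linarith
      _ = (a * n + b + r n) + a / 2 * (k - n) := by rw [hkx]; ring
      _ ≤ a * k + b + r k := by nlinarith
  have hu : 1 < (x ^ (1 / 4 : ℝ)) ^ B' :=
    Real.one_lt_rpow (Real.one_lt_rpow hx1 (by norm_num)) hB'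
  have hpow : ((x ^ (1 / 4 : ℝ)) ^ B') ^ 4 = x ^ B' := by
    rw [← Real.rpow_mul hx0, ← Real.rpow_natCast, ← Real.rpow_mul hx0]
    congr 1
    push_cast
    ring
  have hs : 0 < x ^ (1 / 4 : ℝ) := Real.rpow_pos_of_pos (by linarith) _
  have hdom : lam k * (x ^ (1 / 4 : ℝ)) ^ B' ≤ lam n := by
    rw [hlam n hn3, hlam k hk3]
    calc (a * k + b + r k) ^ (-B') * (x ^ (1 / 4 : ℝ)) ^ B'
        ≤ (x ^ (1 / 4 : ℝ) * (a * n + b + r n)) ^ (-B') * (x ^ (1 / 4 : ℝ)) ^ B' := by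
          gcongr ?_ * _
          exact Real.rpow_le_rpow_of_nonpos (by positivity) hgrow (by linarith)
      _ = (a * n + b + r n) ^ (-B') := by
          rw [Real.mul_rpow hs.le hcn.le, mul_right_comm, ← Real.rpow_add hs]
          simp
  have hmain := div_sub_le_four_mul_pow_div (hpos n (hN₀.trans hn3)) hu hdom
  rw [hpow] at hmain
  have : (0 : ℝ) ≤ 4 * (n : ℝ) ^ (-min 1 B') := by positivity
  linarith
end

section
/- Let a > 0, B̃ > 0, δ > 0, b ∈ ℝ, and let (λ_n) be a positive decreasing sequence with λ_n = (a n + b + O(n^{-δ}))^{-B̃}. Then there exist a constant C > 0 and N such that for all n ≥ N, the sum Σ_{k=1}^{n−1} [λ_n / (λ_k − λ_n)] · k^{-(1+δ)} is at most C log(n) / n^{min{1, δ, B̃}}; in particular this sum tends to 0 as n → ∞. -/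
open Filter

/-- For `0 < m ≤ min 1 B`, the inequality `m x ^ (m - 1) (x - 1) ≤ x ^ B - 1` at `x ≥ 1`. -/
lemma mul_rpow_mul_sub_one_le_rpow_sub_one {m B x : ℝ} (hm : 0 < m) (hm1 : m ≤ 1) (hmB : m ≤ B)
    (hx : 1 ≤ x) : m * x ^ (m - 1) * (x - 1) ≤ x ^ B - 1 := by
  have hx0 : 0 < x := by linarith
  have h1 : x ^ m ≤ x ^ B := Real.rpow_le_rpow_of_exponent_le hx hmB
  have h2 : (1 + (x⁻¹ - 1)) ^ m ≤ 1 + m * (x⁻¹ - 1) :=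
    rpow_one_add_le_one_add_mul_self (by linarith [inv_pos.2 hx0]) hm.le hm1
  rw [add_sub_cancel, Real.inv_rpow hx0.le] at h2
  have hp : 0 < x ^ m := Real.rpow_pos_of_pos hx0 m
  have h3 := mul_le_mul_of_nonneg_left h2 hp.le
  rw [mul_inv_cancel₀ hp.ne'] at h3
  have h4 : m * x ^ (m - 1) * (x - 1) = x ^ m - x ^ m * (1 + m * (x⁻¹ - 1)) := by
    rw [Real.rpow_sub_one hx0.ne']
    field_simp
    ring
  linarith

lemma rpow_neg_div_sub_rpow_neg_le {m B u v : ℝ} (hm : 0 < m) (hm1 : m ≤ 1) (hmB : m ≤ B)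
    (hu : 0 < u) (huv : u < v) :
    v ^ (-B) / (u ^ (-B) - v ^ (-B)) ≤ m⁻¹ * (v ^ (1 - m) * u ^ m) / (v - u) := by
  have hv : 0 < v := hu.trans huv
  have hx : 1 < v / u := (one_lt_div hu).2 huv
  have hx0 : 0 < v / u := by positivity
  have key := mul_rpow_mul_sub_one_le_rpow_sub_one hm hm1 hmB hx.le
  have hpos : 0 < m * (v / u) ^ (m - 1) * (v / u - 1) := by
    have : 0 < v / u - 1 := by linarith
    positivity
  have hL : v ^ (-B) / (u ^ (-B) - v ^ (-B)) = 1 / ((v / u) ^ B - 1) := by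
    have h1 : 0 < u ^ B := Real.rpow_pos_of_pos hu B
    have h2 : 0 < v ^ B := Real.rpow_pos_of_pos hv B
    have h3 : u ^ B < v ^ B := Real.rpow_lt_rpow hu.le huv (by linarith)
    have h4 : v ^ B - u ^ B ≠ 0 := by linarith
    rw [Real.rpow_neg hu.le, Real.rpow_neg hv.le, Real.div_rpow hv.le hu.le]
    have h5 : (u ^ B)⁻¹ - (v ^ B)⁻¹ = (v ^ B - u ^ B) / (u ^ B * v ^ B) := by
      field_simp
    have h6 : v ^ B / u ^ B - 1 = (v ^ B - u ^ B) / u ^ B := by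
      field_simp
    rw [h5, h6]
    field_simp
  have hR : m⁻¹ * (v ^ (1 - m) * u ^ m) / (v - u) = 1 / (m * (v / u) ^ (m - 1) * (v / u - 1)) := by
    have h1 : 0 < u ^ m := Real.rpow_pos_of_pos hu m
    have h2 : 0 < v ^ m := Real.rpow_pos_of_pos hv m
    have h4 : v - u ≠ 0 := by linarith
    have h6 : v / u - 1 = (v - u) / u := by field_simp
    rw [h6, Real.rpow_sub_one hx0.ne', Real.rpow_sub hv, Real.rpow_one,
      Real.div_rpow hv.le hu.le]
    field_simp
  rw [hL, hR]
  exact one_div_le_one_div_of_le hpos key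

lemma sum_Ico_inv_le_one_add_log (n : ℕ) :
    ∑ k ∈ Finset.Ico 1 n, (k : ℝ)⁻¹ ≤ 1 + Real.log n := by
  have h := harmonic_le_one_add_log n
  rw [harmonic_eq_sum_Icc] at h
  push_cast at h
  refine (Finset.sum_le_sum_of_subset_of_nonneg ?_ ?_).trans h
  · intro k hk
    simp only [Finset.mem_Ico, Finset.mem_Icc] at hk ⊢
    omega
  · intros
    positivity

lemma sum_Ico_inv_mul_inv_sub_le {n : ℕ} (hn : 1 ≤ n) :
    ∑ k ∈ Finset.Ico 1 n, (k : ℝ)⁻¹ * ((n : ℝ) - k)⁻¹ ≤ 2 * (1 + Real.log n) / n := by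
  have hn0 : (0 : ℝ) < n := by exact_mod_cast hn
  have hterm : ∀ k ∈ Finset.Ico 1 n, (k : ℝ)⁻¹ * ((n : ℝ) - k)⁻¹ =
      (n : ℝ)⁻¹ * ((k : ℝ)⁻¹ + ((n - k : ℕ) : ℝ)⁻¹) := by
    intro k hk
    rw [Finset.mem_Ico] at hk
    have h1 : (0 : ℝ) < k := by exact_mod_cast hk.1
    have h2 : (0 : ℝ) < n - k := sub_pos.2 (by exact_mod_cast hk.2)
    rw [Nat.cast_sub hk.2.le]
    have := h2.ne'
    field_simp
    ring
  have hrefl : ∑ k ∈ Finset.Ico 1 n, ((n - k : ℕ) : ℝ)⁻¹ = ∑ k ∈ Finset.Ico 1 n, (k : ℝ)⁻¹ := by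
    refine Finset.sum_nbij' (fun k => n - k) (fun k => n - k) ?_ ?_ ?_ ?_ ?_ <;>
      simp only [Finset.mem_Ico] <;> intros <;> first | trivial | omega
  rw [Finset.sum_congr rfl hterm, ← Finset.mul_sum, Finset.sum_add_distrib, hrefl, div_eq_inv_mul]
  have := sum_Ico_inv_le_one_add_log n
  gcongr
  linarith

/-- From some index on, the base `a n + b + r n` has gaps of at least `a / 2` per step and is
squeezed between `0` and a multiple of `n`. -/
lemma exists_linear_control {a b C δ : ℝ} (ha : 0 < a) (hδ : 0 < δ) {r : ℕ → ℝ} {N : ℕ}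
    (hr : ∀ n, N ≤ n → |r n| ≤ C * (n : ℝ) ^ (-δ)) :
    ∃ c > (0 : ℝ), ∃ K : ℕ, N ≤ K ∧ 1 ≤ K ∧
      (∀ n, K ≤ n → 0 < a * n + b + r n ∧ a * n + b + r n ≤ c * n) ∧
      ∀ k n, K ≤ k → k < n → a / 2 * ((n : ℝ) - k) ≤ (a * n + b + r n) - (a * k + b + r k) := by
  have hlim : Tendsto (fun n : ℕ => C * (n : ℝ) ^ (-δ)) atTop (nhds 0) := by
    simpa using ((tendsto_rpow_neg_atTop hδ).comp tendsto_natCast_atTop_atTop).const_mul C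
  have hev := hlim.eventually_le_const (show (0 : ℝ) < a / 4 by linarith)
  have hev2 : ∀ᶠ n : ℕ in atTop, (a + |b|) / a ≤ (n : ℝ) :=
    tendsto_natCast_atTop_atTop.eventually_ge_atTop _
  obtain ⟨K, hK⟩ := eventually_atTop.1 (hev.and (hev2.and ((eventually_ge_atTop N).and
    (eventually_ge_atTop 1))))
  have hsmall : ∀ n, K ≤ n → -(a / 4) ≤ r n ∧ r n ≤ a / 4 := fun n hn =>
    abs_le.1 ((hr n (hK n hn).2.2.1).trans (hK n hn).1)
  refine ⟨2 * a + |b|, by positivity, K, (hK K le_rfl).2.2.1, (hK K le_rfl).2.2.2, ?_, ?_⟩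
  · intro n hn
    obtain ⟨h1, h2⟩ := hsmall n hn
    have h3 := (div_le_iff₀ ha).1 (hK n hn).2.1
    have h4 : (1 : ℝ) ≤ n := by exact_mod_cast (hK n hn).2.2.2
    have h5 := neg_abs_le b
    have h6 := le_abs_self b
    have h7 := abs_nonneg b
    constructor
    · nlinarith
    · nlinarith
  · intro k n hk hkn
    obtain ⟨h1, h2⟩ := hsmall k hk
    obtain ⟨h3, h4⟩ := hsmall n (hk.trans hkn.le)
    have h5 : (k : ℝ) + 1 ≤ n := by exact_mod_cast hkn
    nlinarith

/-- Pointwise bound on the ratios `lam n / (lam k - lam n)`, uniform in `1 ≤ k < n`. -/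
lemma HasTwoTermAsymp.exists_ratio_le {a b B' δ m : ℝ} (ha : 0 < a) (hδ : 0 < δ)
    (hm : 0 < m) (hm1 : m ≤ 1) (hmB : m ≤ B') {lam : ℕ → ℝ}
    (hpos : ∀ n, 1 ≤ n → 0 < lam n)
    (hdec : ∀ m n, 1 ≤ m → m ≤ n → lam n ≤ lam m)
    (hasymp : HasTwoTermAsymp lam a b B' δ) :
    ∃ D > (0 : ℝ), ∃ N : ℕ, ∀ n, N ≤ n → ∀ k, 1 ≤ k → k < n →
      lam n / (lam k - lam n) ≤ D * ((n : ℝ) ^ (1 - m) * (k : ℝ) ^ m / ((n : ℝ) - k)) := by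
  obtain ⟨r, C, N, hN, hr, hlam⟩ := hasymp
  obtain ⟨c, hc, K, hNK, hK1, hbd, hgap⟩ := exists_linear_control (b := b) ha hδ hr
  have hmain : ∀ n k, K ≤ k → k < n → lam n < lam k ∧ lam n / (lam k - lam n) ≤
      (2 * c / (a * m)) * ((n : ℝ) ^ (1 - m) * (k : ℝ) ^ m / ((n : ℝ) - k)) := by
    intro n k hk hkn
    have hd : (0 : ℝ) < n - k := sub_pos.2 (by exact_mod_cast hkn)
    have hg := hgap k n hk hkn
    obtain ⟨hu, huc⟩ := hbd k hk
    obtain ⟨hv, hvc⟩ := hbd n (hk.trans hkn.le)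
    rw [hlam n (hNK.trans (hk.trans hkn.le)), hlam k (hNK.trans hk)]
    set u := a * k + b + r k
    set v := a * n + b + r n
    have hg0 : 0 < a / 2 * ((n : ℝ) - k) := by positivity
    have huv : u < v := by linarith
    refine ⟨Real.rpow_lt_rpow_of_neg hu huv (by linarith), ?_⟩
    calc v ^ (-B') / (u ^ (-B') - v ^ (-B'))
        ≤ m⁻¹ * (v ^ (1 - m) * u ^ m) / (v - u) := rpow_neg_div_sub_rpow_neg_le hm hm1 hmB hu huv
      _ ≤ m⁻¹ * ((c * n) ^ (1 - m) * (c * k) ^ m) / (a / 2 * ((n : ℝ) - k)) := by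
          have : 0 ≤ 1 - m := by linarith
          gcongr
      _ = (2 * c / (a * m)) * ((n : ℝ) ^ (1 - m) * (k : ℝ) ^ m / ((n : ℝ) - k)) := by
          have hcm : c ^ (1 - m) * c ^ m = c := by
            rw [← Real.rpow_add hc, sub_add_cancel, Real.rpow_one]
          rw [Real.mul_rpow hc.le n.cast_nonneg, Real.mul_rpow hc.le k.cast_nonneg,
            show c ^ (1 - m) * (n : ℝ) ^ (1 - m) * (c ^ m * (k : ℝ) ^ m) =
              c * ((n : ℝ) ^ (1 - m) * (k : ℝ) ^ m) by
                rw [mul_mul_mul_comm, hcm]]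
          have := hd.ne'
          field_simp
  have hKm : 1 ≤ (K : ℝ) ^ m := Real.one_le_rpow (by exact_mod_cast hK1) hm.le
  have hE : 0 < 2 * c / (a * m) := by positivity
  refine ⟨2 * (K : ℝ) ^ m * (2 * c / (a * m)), by positivity, 2 * K, ?_⟩
  intro n hn k hk hkn
  have hk1 : (1 : ℝ) ≤ k := by exact_mod_cast hk
  have hd : (0 : ℝ) < n - k := sub_pos.2 (by exact_mod_cast hkn)
  rcases le_or_gt K k with hKk | hKk
  · refine (hmain n k hKk hkn).2.trans ?_
    have : 2 * c / (a * m) ≤ 2 * (K : ℝ) ^ m * (2 * c / (a * m)) := by nlinarith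
    gcongr
  · have hKn : K < n := by omega
    obtain ⟨hlt, hle⟩ := hmain n K le_rfl hKn
    have hn2 : (2 * K : ℝ) ≤ n := by exact_mod_cast hn
    have hkm : 1 ≤ (k : ℝ) ^ m := Real.one_le_rpow hk1 hm.le
    have hln := hpos n (by omega)
    have hlk := hdec k K hk hKk.le
    have hsub : 0 < lam K - lam n := by linarith
    have hd2 : ((n : ℝ) - k) / 2 ≤ n - K := by linarith
    calc lam n / (lam k - lam n) ≤ lam n / (lam K - lam n) := by gcongr
      _ ≤ _ := hle
      _ ≤ (2 * c / (a * m)) * ((n : ℝ) ^ (1 - m) * ((K : ℝ) ^ m * (k : ℝ) ^ m) /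
            (((n : ℝ) - k) / 2)) := by
          gcongr
          exact le_mul_of_one_le_right (by positivity) hkm
      _ = _ := by
          have := hd.ne'
          field_simp

/-- If `(lam n)` is a positive decreasing sequence with
`lam n = (a n + b + O(n^(-δ)))^(-B')`, then there are `C > 0` and `N` such that for all
`n ≥ N`, `∑_{k=1}^{n-1} (lam n / (lam k - lam n)) k^(-(1+δ)) ≤ C log n / n^(min {1, δ, B'})`;
in particular this sum tends to `0` as `n → ∞`. -/
theorem sum_ratio_bound_lower_range
    (a b B' δ : ℝ) (ha : 0 < a) (hB' : 0 < B') (hδ : 0 < δ)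
    (lam : ℕ → ℝ)
    (hpos : ∀ n, 1 ≤ n → 0 < lam n)
    (hdec : ∀ m n, 1 ≤ m → m ≤ n → lam n ≤ lam m)
    (hasymp : HasTwoTermAsymp lam a b B' δ) :
    (∃ C > (0 : ℝ), ∃ N : ℕ, ∀ n, N ≤ n →
      ∑ k ∈ Finset.Ico 1 n, lam n / (lam k - lam n) * (k : ℝ) ^ (-(1 + δ)) ≤
        C * Real.log n / (n : ℝ) ^ min 1 (min δ B')) ∧
    Tendsto (fun n : ℕ => ∑ k ∈ Finset.Ico 1 n, lam n / (lam k - lam n) * (k : ℝ) ^ (-(1 + δ)))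
      atTop (nhds 0) := by
  set m := min 1 (min δ B')
  have hm : 0 < m := lt_min one_pos (lt_min hδ hB')
  have hm1 : m ≤ 1 := min_le_left _ _
  have hmδ : m ≤ δ := (min_le_right _ _).trans (min_le_left _ _)
  have hmB : m ≤ B' := (min_le_right _ _).trans (min_le_right _ _)
  obtain ⟨D, hD, N, hratio⟩ := hasymp.exists_ratio_le ha hδ hm hm1 hmB hpos hdec
  have hbound : ∀ n, max N 3 ≤ n →
      ∑ k ∈ Finset.Ico 1 n, lam n / (lam k - lam n) * (k : ℝ) ^ (-(1 + δ)) ≤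
        4 * D * Real.log n / (n : ℝ) ^ m := by
    intro n hn
    have hn3 : 3 ≤ n := (le_max_right _ _).trans hn
    have hn3' : (3 : ℝ) ≤ n := by exact_mod_cast hn3
    have hn0 : (0 : ℝ) < n := by linarith
    have hlog : 1 ≤ Real.log n := by
      rw [Real.le_log_iff_exp_le hn0]
      linarith [Real.exp_one_lt_d9]
    calc ∑ k ∈ Finset.Ico 1 n, lam n / (lam k - lam n) * (k : ℝ) ^ (-(1 + δ))
        ≤ ∑ k ∈ Finset.Ico 1 n, D * (n : ℝ) ^ (1 - m) * ((k : ℝ)⁻¹ * ((n : ℝ) - k)⁻¹) := by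
          refine Finset.sum_le_sum fun k hk => ?_
          rw [Finset.mem_Ico] at hk
          have hk1 : (1 : ℝ) ≤ k := by exact_mod_cast hk.1
          have hk0 : (0 : ℝ) < k := by linarith
          have hd : (0 : ℝ) < n - k := sub_pos.2 (by exact_mod_cast hk.2)
          have hexp : (k : ℝ) ^ m * (k : ℝ) ^ (-(1 + δ)) ≤ (k : ℝ)⁻¹ := by
            rw [← Real.rpow_add hk0, ← Real.rpow_neg_one]
            exact Real.rpow_le_rpow_of_exponent_le hk1 (by linarith)
          calc lam n / (lam k - lam n) * (k : ℝ) ^ (-(1 + δ))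
              ≤ D * ((n : ℝ) ^ (1 - m) * (k : ℝ) ^ m / ((n : ℝ) - k)) * (k : ℝ) ^ (-(1 + δ)) := by
                gcongr
                exact hratio n ((le_max_left _ _).trans hn) k hk.1 hk.2
            _ = D * (n : ℝ) ^ (1 - m) * (((k : ℝ) ^ m * (k : ℝ) ^ (-(1 + δ))) *
                  ((n : ℝ) - k)⁻¹) := by ring
            _ ≤ _ := by gcongr
      _ = D * (n : ℝ) ^ (1 - m) * ∑ k ∈ Finset.Ico 1 n, (k : ℝ)⁻¹ * ((n : ℝ) - k)⁻¹ := by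
          rw [Finset.mul_sum]
      _ ≤ D * (n : ℝ) ^ (1 - m) * (2 * (Real.log n + Real.log n) / n) := by
          gcongr
          refine (sum_Ico_inv_mul_inv_sub_le (by omega)).trans ?_
          gcongr
      _ = 4 * D * Real.log n / (n : ℝ) ^ m := by
          rw [Real.rpow_sub hn0, Real.rpow_one]
          field_simp
          ring
  refine ⟨⟨4 * D, by positivity, max N 3, hbound⟩, ?_⟩
  have hlim : Tendsto (fun n : ℕ => 4 * D * Real.log n / (n : ℝ) ^ m) atTop (nhds 0) := by
    have h := ((isLittleO_log_rpow_atTop hm).tendsto_div_nhds_zero.comp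
      tendsto_natCast_atTop_atTop).const_mul (4 * D)
    simpa [Function.comp_def, mul_div_assoc] using h
  refine tendsto_of_tendsto_of_tendsto_of_le_of_le' tendsto_const_nhds hlim ?_
    ((eventually_ge_atTop (max N 3)).mono hbound)
  refine Eventually.of_forall fun n => Finset.sum_nonneg fun k hk => ?_
  rw [Finset.mem_Ico] at hk
  have h1 := hpos n (by omega)
  have h2 := sub_nonneg.2 (hdec k n hk.1 hk.2.le)
  positivity
end

section
/- Let a > 0, B̃ > 0, δ > 0, b ∈ ℝ, and let (λ_n) be a positive decreasing sequence with λ_n = (a n + b + O(n^{-δ}))^{-B̃}. Then there exist a constant C > 0 and N such that for all n ≥ N, the sum Σ_{k=n+1}^{∞} [λ_n / (λ_n − λ_k)] · k^{-(1+δ)} converges and is at most C log(n) / n^{min{1, δ, B̃}}; in particular this sum tends to 0 as n → ∞. -/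
open Filter

/-- The summand `(lam n / (lam n - lam k)) * k^(-(1+δ))` of the tail sum
`∑_{k=n+1}^{∞}`, extended by `0` for `k ≤ n`. -/
noncomputable def tailTerm (lam : ℕ → ℝ) (δ : ℝ) (n k : ℕ) : ℝ :=
  if n < k then lam n / (lam n - lam k) * (k : ℝ) ^ (-(1 + δ)) else 0

/-- A Bernoulli-type bound valid for every positive exponent. -/
lemma min_one_mul_one_sub_le_one_sub_rpow {t p : ℝ} (ht : 0 < t) (ht1 : t ≤ 1) (hp : 0 < p) :
    min 1 p * (1 - t) ≤ 1 - t ^ p := by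
  rcases le_total 1 p with h | h
  · have := Real.rpow_le_rpow_of_exponent_ge ht ht1 h
    rw [Real.rpow_one] at this
    rw [min_eq_left h]
    linarith
  · have := rpow_one_add_le_one_add_mul_self (s := t - 1) (by linarith) hp.le h
    rw [add_sub_cancel] at this
    rw [min_eq_right h]
    linarith

lemma rpow_neg_div_sub_le {x y p : ℝ} (hx : 0 < x) (hxy : x < y) (hp : 0 < p) :
    x ^ (-p) / (x ^ (-p) - y ^ (-p)) ≤ (min 1 p)⁻¹ * (y / (y - x)) := by
  have hy : 0 < y := hx.trans hxy
  have hc : 0 < min 1 p := lt_min one_pos hp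
  have h := min_one_mul_one_sub_le_one_sub_rpow (div_pos hx hy) ((div_le_one hy).2 hxy.le) hp
  have hxp : 0 < x ^ p := Real.rpow_pos_of_pos hx p
  have hyp : 0 < y ^ p := Real.rpow_pos_of_pos hy p
  have hsub : 1 - x / y = (y - x) / y := by field_simp
  have hpos : 0 < min 1 p * (1 - x / y) := by
    rw [hsub]
    exact mul_pos hc (div_pos (sub_pos.2 hxy) hy)
  have heq : x ^ (-p) / (x ^ (-p) - y ^ (-p)) = (1 - (x / y) ^ p)⁻¹ := by
    have hfac : x ^ (-p) - y ^ (-p) = x ^ (-p) * (1 - (x / y) ^ p) := by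
      rw [Real.div_rpow hx.le hy.le, Real.rpow_neg hx.le, Real.rpow_neg hy.le]
      field_simp
    rw [hfac, div_mul_eq_div_div, div_self (Real.rpow_pos_of_pos hx _).ne', one_div]
  rw [heq]
  calc (1 - (x / y) ^ p)⁻¹ ≤ (min 1 p * (1 - x / y))⁻¹ := inv_anti₀ hpos h
    _ = _ := by rw [hsub, mul_inv, inv_div]

lemma rpow_neg_one_add_le_sub {x δ : ℝ} (hx : 0 < x) (hδ : 0 < δ) :
    (x + 1) ^ (-(1 + δ)) ≤ δ⁻¹ * (x ^ (-δ) - (x + 1) ^ (-δ)) := by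
  have hx1 : 0 < x + 1 := by linarith
  have hlog : Real.log (x / (x + 1)) ≤ -(1 / (x + 1)) := by
    have := Real.log_le_sub_one_of_pos (div_pos hx hx1)
    have h2 : x / (x + 1) - 1 = -(1 / (x + 1)) := by field_simp; ring
    linarith
  have hkey : 1 + δ / (x + 1) ≤ (x / (x + 1)) ^ (-δ) := by
    rw [Real.rpow_def_of_pos (div_pos hx hx1)]
    have h1 := Real.add_one_le_exp (Real.log (x / (x + 1)) * -δ)
    have h2 := mul_le_mul_of_nonneg_right hlog hδ.le
    have h3 : -(1 / (x + 1)) * δ = -(δ / (x + 1)) := by ring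
    linarith
  have hP : 0 < (x + 1) ^ (-δ) := Real.rpow_pos_of_pos hx1 _
  rw [Real.div_rpow hx.le hx1.le, le_div_iff₀ hP] at hkey
  have hsplit : (x + 1) ^ (-(1 + δ)) = (x + 1) ^ (-δ) / (x + 1) := by
    rw [neg_add', sub_eq_add_neg, Real.rpow_add hx1, Real.rpow_neg_one,
      ← div_eq_inv_mul]
  rw [hsplit, inv_mul_eq_div, le_div_iff₀ hδ]
  have : (1 + δ / (x + 1)) * (x + 1) ^ (-δ)
      = (x + 1) ^ (-δ) + (x + 1) ^ (-δ) / (x + 1) * δ := by ring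
  linarith

lemma sum_range_rpow_neg_one_add_le {δ : ℝ} (hδ : 0 < δ) {n : ℕ} (hn : 1 ≤ n) (M : ℕ) :
    ∑ i ∈ Finset.range M, ((n + i : ℕ) + 1 : ℝ) ^ (-(1 + δ)) ≤ δ⁻¹ * (n : ℝ) ^ (-δ) := by
  calc ∑ i ∈ Finset.range M, ((n + i : ℕ) + 1 : ℝ) ^ (-(1 + δ))
      ≤ ∑ i ∈ Finset.range M,
          δ⁻¹ * (((n + i : ℕ) : ℝ) ^ (-δ) - ((n + (i + 1) : ℕ) : ℝ) ^ (-δ)) := by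
        refine Finset.sum_le_sum fun i _ => ?_
        have := rpow_neg_one_add_le_sub (x := ((n + i : ℕ) : ℝ)) (by positivity) hδ
        rwa [← Nat.cast_add_one] at this ⊢
    _ = δ⁻¹ * ((n : ℝ) ^ (-δ) - ((n + M : ℕ) : ℝ) ^ (-δ)) := by
        rw [← Finset.mul_sum, Finset.sum_range_sub' (fun i => ((n + i : ℕ) : ℝ) ^ (-δ)) M,
          add_zero]
    _ ≤ _ := by
        have : 0 ≤ ((n + M : ℕ) : ℝ) ^ (-δ) := by positivity
        gcongr
        linarith

lemma sum_range_inv_mul_rpow_neg_le {δ : ℝ} (hδ : 0 < δ) {n : ℕ} (hn : 1 ≤ n) (M : ℕ) :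
    ∑ j ∈ Finset.range M, ((j : ℝ) + 1)⁻¹ * ((n : ℝ) + j + 1) ^ (-δ)
      ≤ (1 + Real.log n + δ⁻¹) * (n : ℝ) ^ (-δ) := by
  have hn0 : (0 : ℝ) < n := by exact_mod_cast hn
  calc ∑ j ∈ Finset.range M, ((j : ℝ) + 1)⁻¹ * ((n : ℝ) + j + 1) ^ (-δ)
      ≤ ∑ j ∈ Finset.range (n + M), ((j : ℝ) + 1)⁻¹ * ((n : ℝ) + j + 1) ^ (-δ) :=
        Finset.sum_le_sum_of_subset_of_nonneg (Finset.range_mono (by omega))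
          fun j _ _ => by positivity
    _ ≤ (1 + Real.log n) * (n : ℝ) ^ (-δ) + δ⁻¹ * (n : ℝ) ^ (-δ) := by
        rw [Finset.sum_range_add]
        refine add_le_add ?_ ((Finset.sum_le_sum fun i _ => ?_).trans
          (sum_range_rpow_neg_one_add_le hδ hn M))
        · have hharm := harmonic_le_one_add_log n
          rw [harmonic] at hharm
          push_cast at hharm
          refine le_trans ?_ (mul_le_mul_of_nonneg_right hharm (by positivity))
          rw [Finset.sum_mul]
          refine Finset.sum_le_sum fun j _ => mul_le_mul_of_nonneg_left ?_ (by positivity)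
          exact Real.rpow_le_rpow_of_nonpos hn0 (by linarith [(j.cast_nonneg : (0 : ℝ) ≤ j)])
            (by linarith)
        · have hpos : (0 : ℝ) < ((n + i : ℕ) : ℝ) + 1 := by positivity
          rw [neg_add, Real.rpow_add hpos, Real.rpow_neg_one]
          refine mul_le_mul_of_nonneg_left ?_ (by positivity)
          exact Real.rpow_le_rpow_of_nonpos hpos (by linarith) (by linarith)
    _ = _ := by ring

lemma tailTerm_nonneg {lam : ℕ → ℝ} {δ : ℝ} (hpos : ∀ n, 1 ≤ n → 0 < lam n)
    (hdec : ∀ m n, 1 ≤ m → m ≤ n → lam n ≤ lam m) {n : ℕ} (hn : 1 ≤ n) (k : ℕ) :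
    0 ≤ tailTerm lam δ n k := by
  rw [tailTerm]
  split_ifs with h
  · have := sub_nonneg.2 (hdec n k hn h.le)
    have := hpos n hn
    positivity
  · exact le_rfl

lemma HasTwoTermAsymp.exists_tailTerm_le {lam : ℕ → ℝ} {a b B' δ : ℝ} (ha : 0 < a)
    (hB' : 0 < B') (hδ : 0 < δ) (h : HasTwoTermAsymp lam a b B' δ) :
    ∃ K > (0 : ℝ), ∃ N : ℕ, ∀ n, N ≤ n → ∀ j : ℕ,
      tailTerm lam δ n (n + 1 + j) ≤ K * (((j : ℝ) + 1)⁻¹ * ((n : ℝ) + j + 1) ^ (-δ)) := by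
  obtain ⟨r, C, N₀, -, hr, hlam⟩ := h
  have hsmall : ∀ᶠ n : ℕ in atTop, C * (n : ℝ) ^ (-δ) ≤ a / 4 := by
    have := ((tendsto_rpow_neg_atTop hδ).comp tendsto_natCast_atTop_atTop).const_mul C
    rw [mul_zero] at this
    exact this.eventually_le_const (by positivity)
  have hlarge : ∀ᶠ n : ℕ in atTop, (|b| + a) / a ≤ (n : ℝ) :=
    tendsto_natCast_atTop_atTop.eventually_ge_atTop _
  obtain ⟨N, hN⟩ := eventually_atTop.1 (hsmall.and (hlarge.and (eventually_ge_atTop N₀)))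
  have hc : 0 < min 1 B' := lt_min one_pos hB'
  refine ⟨(min 1 B')⁻¹ * 4, by positivity, N, fun n hn j => ?_⟩
  have hkn : N ≤ n + 1 + j := by omega
  obtain ⟨hn1, hn2, hn3⟩ := hN n hn
  obtain ⟨hk1, hk2, hk3⟩ := hN (n + 1 + j) hkn
  have hrn := abs_le.1 ((hr n hn3).trans hn1)
  have hrk := abs_le.1 ((hr (n + 1 + j) hk3).trans hk1)
  rw [div_le_iff₀ ha] at hn2 hk2
  have hb := neg_abs_le b
  have hb' := le_abs_self b
  rw [tailTerm, if_pos (by omega), hlam n hn3, hlam (n + 1 + j) hk3]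
  push_cast at hk2 ⊢
  set x : ℝ := a * n + b + r n with hx
  set y : ℝ := a * (n + 1 + j) + b + r (n + 1 + j) with hy
  have hj : (0 : ℝ) ≤ j := j.cast_nonneg
  have haj : 0 ≤ a * j := by positivity
  have hxpos : 0 < x := by linarith
  have hdiff : a / 2 * (j + 1) ≤ y - x := by linarith
  have hdpos : 0 < a / 2 * ((j : ℝ) + 1) := by positivity
  have hyle : y ≤ 2 * a * (n + j + 1) := by linarith
  have hkpos : (0 : ℝ) < (n : ℝ) + j + 1 := by positivity
  have hfrac : y / (y - x) ≤ 4 * ((j : ℝ) + 1)⁻¹ * (n + j + 1) := by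
    calc y / (y - x) ≤ 2 * a * (n + j + 1) / (a / 2 * (j + 1)) :=
          div_le_div₀ (by positivity) hyle hdpos hdiff
      _ = _ := by field_simp; ring
  have hmain := (rpow_neg_div_sub_le hxpos (by linarith : x < y) hB').trans
    (mul_le_mul_of_nonneg_left hfrac (inv_nonneg.2 hc.le))
  have hk : (n : ℝ) + 1 + j = n + j + 1 := by ring
  rw [hk, neg_add, Real.rpow_add hkpos, Real.rpow_neg_one]
  refine (mul_le_mul_of_nonneg_right hmain (by positivity)).trans_eq ?_
  field_simp

lemma sum_range_tailTerm_le {lam : ℕ → ℝ} {δ K : ℝ} (hδ : 0 < δ) (hK : 0 < K)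
    (hpos : ∀ n, 1 ≤ n → 0 < lam n) (hdec : ∀ m n, 1 ≤ m → m ≤ n → lam n ≤ lam m)
    {n : ℕ} (hn : 1 ≤ n)
    (h : ∀ j : ℕ,
      tailTerm lam δ n (n + 1 + j) ≤ K * (((j : ℝ) + 1)⁻¹ * ((n : ℝ) + j + 1) ^ (-δ)))
    (M : ℕ) :
    ∑ k ∈ Finset.range M, tailTerm lam δ n k
      ≤ K * ((1 + Real.log n + δ⁻¹) * (n : ℝ) ^ (-δ)) := by
  calc ∑ k ∈ Finset.range M, tailTerm lam δ n k
      ≤ ∑ k ∈ Finset.range (n + 1 + M), tailTerm lam δ n k :=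
        Finset.sum_le_sum_of_subset_of_nonneg (Finset.range_mono (by omega))
          fun k _ _ => tailTerm_nonneg hpos hdec hn k
    _ = ∑ j ∈ Finset.range M, tailTerm lam δ n (n + 1 + j) := by
        rw [Finset.sum_range_add, add_eq_right]
        refine Finset.sum_eq_zero fun k hk => if_neg ?_
        rw [Finset.mem_range] at hk
        omega
    _ ≤ ∑ j ∈ Finset.range M, K * (((j : ℝ) + 1)⁻¹ * ((n : ℝ) + j + 1) ^ (-δ)) :=
        Finset.sum_le_sum fun j _ => h j
    _ ≤ _ := by
        rw [← Finset.mul_sum]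
        exact mul_le_mul_of_nonneg_left (sum_range_inv_mul_rpow_neg_le hδ hn M) hK.le

/-- If `(lam n)` is a positive decreasing sequence with
`lam n = (a n + b + O(n^(-δ)))^(-B')`, then there are `C > 0` and `N` such that for all
`n ≥ N` the sum `∑_{k=n+1}^{∞} (lam n / (lam n - lam k)) k^(-(1+δ))` converges and is at
most `C log n / n^(min {1, δ, B'})`; in particular this sum tends to `0` as `n → ∞`. -/
theorem sum_ratio_bound_upper_range
    (a b B' δ : ℝ) (ha : 0 < a) (hB' : 0 < B') (hδ : 0 < δ)
    (lam : ℕ → ℝ)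
    (hpos : ∀ n, 1 ≤ n → 0 < lam n)
    (hdec : ∀ m n, 1 ≤ m → m ≤ n → lam n ≤ lam m)
    (hasymp : HasTwoTermAsymp lam a b B' δ) :
    (∃ C > (0 : ℝ), ∃ N : ℕ, ∀ n, N ≤ n →
      Summable (tailTerm lam δ n) ∧
      ∑' k, tailTerm lam δ n k ≤ C * Real.log n / (n : ℝ) ^ min 1 (min δ B')) ∧
    Tendsto (fun n : ℕ => ∑' k, tailTerm lam δ n k) atTop (nhds 0) := by
  have hbound : ∃ C > (0 : ℝ), ∃ N : ℕ, ∀ n, N ≤ n →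
      Summable (tailTerm lam δ n) ∧
      ∑' k, tailTerm lam δ n k ≤ C * Real.log n / (n : ℝ) ^ min 1 (min δ B') := by
    obtain ⟨K, hK, N, hterm⟩ := hasymp.exists_tailTerm_le ha hB' hδ
    refine ⟨K * (2 + δ⁻¹), by positivity, max N 3, fun n hn => ?_⟩
    have hn3 : 3 ≤ n := (le_max_right _ _).trans hn
    have hn1 : 1 ≤ n := by omega
    have hnonneg := tailTerm_nonneg (δ := δ) hpos hdec hn1
    have hsum := sum_range_tailTerm_le hδ hK hpos hdec hn1
      (hterm n ((le_max_left _ _).trans hn))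
    refine ⟨summable_of_sum_range_le hnonneg hsum,
      (Real.tsum_le_of_sum_range_le hnonneg hsum).trans ?_⟩
    have hn1' : (1 : ℝ) ≤ n := by exact_mod_cast hn1
    have hn3' : (3 : ℝ) ≤ n := by exact_mod_cast hn3
    have hlog : 1 ≤ Real.log n := by
      rw [Real.le_log_iff_exp_le (by linarith)]
      linarith [Real.exp_one_lt_d9]
    have hpow : (n : ℝ) ^ (-δ) ≤ ((n : ℝ) ^ min 1 (min δ B'))⁻¹ := by
      rw [← Real.rpow_neg (by linarith)]
      exact Real.rpow_le_rpow_of_exponent_le hn1'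
        (neg_le_neg ((min_le_right _ _).trans (min_le_left _ _)))
    have hcoef : 1 + Real.log n + δ⁻¹ ≤ (2 + δ⁻¹) * Real.log n := by
      have := mul_le_mul_of_nonneg_left hlog (inv_nonneg.2 hδ.le)
      linarith
    rw [div_eq_mul_inv, mul_assoc, mul_assoc, ← mul_assoc (2 + δ⁻¹)]
    gcongr
  obtain ⟨C, hC, N, hN⟩ := hbound
  refine ⟨⟨C, hC, N, hN⟩, ?_⟩
  have hs : 0 < min 1 (min δ B') := lt_min one_pos (lt_min hδ hB')
  have hlim := (((isLittleO_log_rpow_atTop hs).tendsto_div_nhds_zero).comp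
    tendsto_natCast_atTop_atTop).const_mul C
  rw [mul_zero] at hlim
  refine squeeze_zero' ?_ ?_ hlim
  · filter_upwards [eventually_ge_atTop 1] with n hn
    exact tsum_nonneg (tailTerm_nonneg hpos hdec hn)
  · filter_upwards [eventually_ge_atTop N] with n hn
    exact (hN n hn).2.trans_eq (mul_div_assoc _ _ _)
end
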